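/- arXiv:1209.6019 — 2 statements merged into one kernel-verified Lean document; each statement's English description precedes it below -/
import Mathlib

section
/- If A ∈ B^{m,i} satisfies e_l A = 0 for all l ∈ {1,…,n}, then a_{p,q} = 0 for all 1 ≤ p ≤ i ≤ q ≤ n. Consequently, for every A ∈ B^{m,i} there exist indices l_1,…,l_s ∈ {1,…,n} with e_{l_1}⋯e_{l_s} A equal to the all-zero array, so the crystal graph of B^{m,i} is connected. -/
open Finset

namespace KR

/-- Arrays of integers indexed by (column, row). -/
abbrev Arr := ℕ → ℕ → ℤ

/-- A Dyck path from (1,i) to (i,n). -/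
def IsDyck (n i : ℕ) (L : List (ℕ × ℕ)) : Prop :=
  L ≠ [] ∧ L.head? = some (1, i) ∧ L.getLast? = some (i, n) ∧
    L.Chain' (fun β γ => γ = (β.1, β.2 + 1) ∨ γ = (β.1 + 1, β.2))

/-- Membership in the polytope `B^{m,i}`: nonnegative entries supported on the box
`1 ≤ p ≤ i`, `i ≤ q ≤ n`, with all Dyck path sums bounded by `m`. -/
def InB (n i m : ℕ) (A : Arr) : Prop :=
  (∀ p q, 1 ≤ p → p ≤ i → i ≤ q → q ≤ n → 0 ≤ A p q) ∧
  (∀ p q, ¬(1 ≤ p ∧ p ≤ i ∧ i ≤ q ∧ q ≤ n) → A p q = 0) ∧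
  (∀ L, IsDyck n i L → (L.map fun β => A β.1 β.2).sum ≤ (m : ℤ))

/-- The sum `Σ_{j=1}^{p} a_{j,l−1} + Σ_{j=p}^{i} a_{j,l}` (used for `l > i`). -/
def Fp (i : ℕ) (A : Arr) (l p : ℕ) : ℤ :=
  ∑ j ∈ Icc 1 p, A j (l - 1) + ∑ j ∈ Icc p i, A j l

/-- `p_+^l(A)`: minimal maximizer of `Fp` on `{1,…,i}`. -/
noncomputable def pplus (i : ℕ) (A : Arr) (l : ℕ) : ℕ :=
  sInf {p | p ∈ Icc 1 i ∧ ∀ q ∈ Icc 1 i, Fp i A l q ≤ Fp i A l p}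

/-- `q_+^l(A)`: maximal maximizer of `Fp` on `{1,…,i}`. -/
noncomputable def qplus (i : ℕ) (A : Arr) (l : ℕ) : ℕ :=
  sSup {p | p ∈ Icc 1 i ∧ ∀ q ∈ Icc 1 i, Fp i A l q ≤ Fp i A l p}

/-- The sum `Σ_{j=i}^{p} a_{l,j} + Σ_{j=p}^{n} a_{l+1,j}` (used for `l < i`). -/
def Fm (n i : ℕ) (A : Arr) (l p : ℕ) : ℤ :=
  ∑ j ∈ Icc i p, A l j + ∑ j ∈ Icc p n, A (l + 1) j

/-- `p_−^l(A)`: maximal maximizer of `Fm` on `{i,…,n}`. -/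
noncomputable def pminus (n i : ℕ) (A : Arr) (l : ℕ) : ℕ :=
  sSup {p | p ∈ Icc i n ∧ ∀ q ∈ Icc i n, Fm n i A l q ≤ Fm n i A l p}

/-- `q_−^l(A)`: minimal maximizer of `Fm` on `{i,…,n}`. -/
noncomputable def qminus (n i : ℕ) (A : Arr) (l : ℕ) : ℕ :=
  sInf {p | p ∈ Icc i n ∧ ∀ q ∈ Icc i n, Fm n i A l q ≤ Fm n i A l p}

/-- `φ_l(A)` (depending on the parameter `m` only when `l = i`). -/
noncomputable def phi (n i m : ℕ) (l : ℕ) (A : Arr) : ℤ :=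
  if l = i then (m : ℤ) - ∑ j ∈ Icc 1 (i - 1), A j i - ∑ j ∈ Icc i n, A i j
  else if i < l then
    ∑ j ∈ Icc 1 (pplus i A l), A j (l - 1) - ∑ j ∈ Icc 1 (pplus i A l - 1), A j l
  else
    ∑ j ∈ Icc (pminus n i A l) n, A (l + 1) j - ∑ j ∈ Icc (pminus n i A l + 1) n, A l j

/-- `ε_l(A)` (the parameter `m` is carried along for uniformity; it is not used). -/
noncomputable def eps (n i m : ℕ) (l : ℕ) (A : Arr) : ℤ :=
  if l = i then A i i
  else if i < l then
    ∑ j ∈ Icc (qplus i A l) i, A j l - ∑ j ∈ Icc (qplus i A l + 1) i, A j (l - 1)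
  else
    ∑ j ∈ Icc i (qminus n i A l), A l j - ∑ j ∈ Icc i (qminus n i A l - 1), A (l + 1) j

/-- Update a single entry of an array. -/
def upd (A : Arr) (p q : ℕ) (v : ℤ) : Arr :=
  fun p' q' => if p' = p ∧ q' = q then v else A p' q'

/-- The Kashiwara operator `f_l` (with `none` playing the role of `0`). -/
noncomputable def fop (n i m : ℕ) (l : ℕ) (A : Arr) : Option Arr :=
  if phi n i m l A = 0 then none
  else some <|
    if l = i then upd A i i (A i i + 1)
    else if i < l then
      upd (upd A (pplus i A l) (l - 1) (A (pplus i A l) (l - 1) - 1))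
        (pplus i A l) l (A (pplus i A l) l + 1)
    else
      upd (upd A l (pminus n i A l) (A l (pminus n i A l) + 1))
        (l + 1) (pminus n i A l) (A (l + 1) (pminus n i A l) - 1)

/-- The Kashiwara operator `e_l` (with `none` playing the role of `0`). -/
noncomputable def eop (n i m : ℕ) (l : ℕ) (A : Arr) : Option Arr :=
  if eps n i m l A = 0 then none
  else some <|
    if l = i then upd A i i (A i i - 1)
    else if i < l then
      upd (upd A (qplus i A l) (l - 1) (A (qplus i A l) (l - 1) + 1))
        (qplus i A l) l (A (qplus i A l) l - 1)
    else
      upd (upd A l (qminus n i A l) (A l (qminus n i A l) - 1))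
        (l + 1) (qminus n i A l) (A (l + 1) (qminus n i A l) + 1)

/-- Coefficient of `ω_j` in the simple root `α_r` (column `r` of the Cartan matrix). -/
def cart (j r : ℕ) : ℤ :=
  if r = j then 2 else if r = j + 1 ∨ j = r + 1 then -1 else 0

/-- The weight `wt(A) = mω_i − Σ a_{p,q} α_{p,q}`, expressed in the basis of
fundamental weights: `wtv n i m A j` is the coefficient of `ω_j`. -/
def wtv (n i m : ℕ) (A : Arr) (j : ℕ) : ℤ :=
  (m : ℤ) * (if j = i then 1 else 0) -
    ∑ p ∈ Icc 1 i, ∑ q ∈ Icc i n, A p q * ∑ r ∈ Icc p q, cart j r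

/-- The coefficient `c_l(p,q)` of the pairing `⟨α_l^∨, α_{p,q}⟩`. -/
def clpq (l p q : ℕ) : ℤ :=
  if p = l ∧ q = l then 2
  else if (l = p ∧ p < q) ∨ (p < q ∧ q = l) then 1
  else if l + 1 = p ∨ l = q + 1 then -1
  else 0

/-- The pairing `⟨α_l^∨, wt(A)⟩ = m·δ_{l,i} − Σ_{p,q} a_{p,q}·c_l(p,q)`. -/
def pairing (n i m : ℕ) (l : ℕ) (A : Arr) : ℤ :=
  (m : ℤ) * (if l = i then 1 else 0) -
    ∑ p ∈ Icc 1 i, ∑ q ∈ Icc i n, A p q * clpq l p q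

/-! ### The promotion algorithm -/

/-- Columns, indexed by rows `i,…,n`. -/
abbrev Col := ℕ → ℤ

/-- `Σ_{j=lo}^{p} a_j + Σ_{j=p}^{n} b_j`. -/
def Gc (n lo : ℕ) (a b : Col) (p : ℕ) : ℤ := ∑ j ∈ Icc lo p, a j + ∑ j ∈ Icc p n, b j

/-- `q_−` for two (truncated) columns with rows `lo,…,n`: the minimal maximizer of `Gc`. -/
noncomputable def qmc (n lo : ℕ) (a b : Col) : ℕ :=
  if lo ≤ n then
    max lo (sInf {p | p ∈ Icc lo n ∧ ∀ q ∈ Icc lo n, Gc n lo a b q ≤ Gc n lo a b p})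
  else n

/-- `ε` for two (truncated) columns with rows `lo,…,n`. -/
noncomputable def epsc (n lo : ℕ) (a b : Col) : ℤ :=
  ∑ j ∈ Icc lo (qmc n lo a b), a j - ∑ j ∈ Icc lo (qmc n lo a b - 1), b j

/-- The sequence `l_1 < l_2 < ⋯` of the promotion algorithm:
`l_1 = q_−(a,c)` and `l_{s+1} = q_−((a)^{≥ l_s + 1}, (c)^{≥ l_s + 1})`,
stabilizing at `n`. -/
noncomputable def lfun (n i : ℕ) (a c : Col) : ℕ → ℕ
  | 0 => qmc n i a c
  | s + 1 => qmc n (lfun n i a c s + 1) a c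

/-- The set `{l_1, …, l_t}` (with `l_t = n`). -/
noncomputable def lset (n i : ℕ) (a c : Col) : Finset ℕ := (Finset.range (n + 1)).image (lfun n i a c)

/-- The new column `ĉ` of formula (6.2). -/
noncomputable def hatc (n i : ℕ) (a c : Col) : Col := fun r =>
  if r = n then a n + c n
  else if r ∈ lset n i a c then a r + c r - epsc n (r + 1) a c
  else a r

/-- The output column of one step of the promotion algorithm. -/
noncomputable def prcol (n i : ℕ) (a c : Col) : Col := fun r =>
  if r = i then epsc n i a c
  else if r - 1 ∈ lset n i a c then epsc n r a c
  else c (r - 1)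

/-- The running columns of the promotion algorithm: `cseq 0` is the `i`-th column of `A`,
and `cseq (k+1)` is obtained from the `(i−1−k)`-th column of `A` and `cseq k`. -/
noncomputable def cseq (n i : ℕ) (A : Arr) : ℕ → Col
  | 0 => fun r => A i r
  | k + 1 => hatc n i (fun r => A (i - 1 - k) r) (cseq n i A k)

/-- The `j`-th column of `pr(A)` for `2 ≤ j ≤ i`. -/
noncomputable def prColJ (n i : ℕ) (A : Arr) (j : ℕ) : Col :=
  prcol n i (fun q => A (j - 1) q) (cseq n i A (i - j))

/-- The promotion map `pr` on `B^{m,i}`. -/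
noncomputable def prMap (n i m : ℕ) (A : Arr) : Arr := fun p r =>
  if 1 ≤ p ∧ p ≤ i ∧ i ≤ r ∧ r ≤ n then
    if p = 1 then
      if r = i then
        (m : ℤ) - (∑ j ∈ Icc i n, A i j) - ∑ j ∈ Icc 2 i, prColJ n i A j i
      else
        (∑ j ∈ Icc 1 i, A j (r - 1)) - ∑ j ∈ Icc 2 i, prColJ n i A j r
    else prColJ n i A p r
  else 0

/-- The content `(r_1,…,r_{n+1})` of an array. -/
def cont (n i m : ℕ) (A : Arr) (k : ℕ) : ℤ :=
  if k ≤ i then (m : ℤ) - ∑ q ∈ Icc i n, A k q else ∑ p ∈ Icc 1 i, A p (k - 1)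

/-- Nonnegative arrays supported on the box `1 ≤ p ≤ i`, `i ≤ q ≤ n`. -/
def IsNonnegOnBox (n i : ℕ) (A : Arr) : Prop :=
  (∀ p q, 1 ≤ p → p ≤ i → i ≤ q → q ≤ n → 0 ≤ A p q) ∧
  (∀ p q, ¬(1 ≤ p ∧ p ≤ i ∧ i ≤ q ∧ q ≤ n) → A p q = 0)

/-- The sum `Σ a_{p,q} (q - p + 1)`, i.e. the height of `Σ a_{p,q} α_{p,q}`. -/
def height (n i : ℕ) (A : Arr) : ℤ :=
  ∑ p ∈ Icc 1 i, ∑ q ∈ Icc i n, A p q * ((q : ℤ) - p + 1)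

theorem IsNonnegOnBox.nonneg {n i : ℕ} {A : Arr} (h : IsNonnegOnBox n i A) (p q : ℕ) :
    0 ≤ A p q := by
  by_cases hpq : 1 ≤ p ∧ p ≤ i ∧ i ≤ q ∧ q ≤ n
  · exact h.1 p q hpq.1 hpq.2.1 hpq.2.2.1 hpq.2.2.2
  · exact (h.2 p q hpq).ge

theorem height_nonneg {n i : ℕ} {A : Arr} (h : IsNonnegOnBox n i A) : 0 ≤ height n i A := by
  refine sum_nonneg fun p hp => sum_nonneg fun q hq => mul_nonneg (h.nonneg p q) ?_
  rw [mem_Icc] at hp hq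
  lia

theorem IsNonnegOnBox.upd {n i : ℕ} {A : Arr} (h : IsNonnegOnBox n i A) {p q : ℕ} {v : ℤ}
    (hp : 1 ≤ p ∧ p ≤ i) (hq : i ≤ q ∧ q ≤ n) (hv : 0 ≤ v) :
    IsNonnegOnBox n i (KR.upd A p q v) := by
  refine ⟨fun p' q' _ _ _ _ => ?_, fun p' q' hpq => ?_⟩
  · unfold KR.upd
    split_ifs
    exacts [hv, h.nonneg p' q']
  · unfold KR.upd
    rw [if_neg (by rintro ⟨rfl, rfl⟩; exact hpq ⟨hp.1, hp.2, hq.1, hq.2⟩)]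
    exact h.2 p' q' hpq

theorem height_upd {n i : ℕ} (A : Arr) {p q : ℕ} (v : ℤ)
    (hp : 1 ≤ p ∧ p ≤ i) (hq : i ≤ q ∧ q ≤ n) :
    height n i (upd A p q v) = height n i A + (v - A p q) * ((q : ℤ) - p + 1) := by
  have key : ∀ p' q' : ℕ, upd A p q v p' q' * ((q' : ℤ) - p' + 1) =
      A p' q' * ((q' : ℤ) - p' + 1) +
        if p' = p then if q' = q then (v - A p q) * ((q : ℤ) - p + 1) else 0 else 0 := by
    intro p' q'
    unfold upd
    by_cases h1 : p' = p <;> by_cases h2 : q' = q <;> simp [h1, h2]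
    ring
  unfold height
  simp only [key, sum_add_distrib]
  congr 1
  have : ∀ p' : ℕ, (∑ q' ∈ Icc i n,
      if p' = p then if q' = q then (v - A p q) * ((q : ℤ) - p + 1) else 0 else 0) =
      if p' = p then (v - A p q) * ((q : ℤ) - p + 1) else 0 := by
    intro p'
    split_ifs
    · rw [sum_ite_eq', if_pos (mem_Icc.2 hq)]
    · simp
  simp only [this]
  rw [sum_ite_eq', if_pos (mem_Icc.2 hp)]

theorem sum_Icc_add_sum_Icc_succ (f : ℕ → ℤ) {a p b : ℕ} (hap : a ≤ p + 1) (hpb : p ≤ b) :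
    ∑ j ∈ Icc a p, f j + ∑ j ∈ Icc (p + 1) b, f j = ∑ j ∈ Icc a b, f j := by
  induction b, hpb using Nat.le_induction with
  | base => simp
  | succ b hb ih =>
    rw [sum_Icc_succ_top (by lia), sum_Icc_succ_top (by lia), ← ih]
    ring

theorem exists_argmax_Icc (F : ℕ → ℤ) {a b : ℕ} (hab : a ≤ b) :
    ({p | p ∈ Icc a b ∧ ∀ q ∈ Icc a b, F q ≤ F p} : Set ℕ).Nonempty := by
  obtain ⟨p, hp, h⟩ := exists_max_image (Icc a b) F (nonempty_Icc.2 hab)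
  exact ⟨p, hp, h⟩

theorem qplus_mem {i : ℕ} (hi : 1 ≤ i) (A : Arr) (l : ℕ) :
    qplus i A l ∈ Icc 1 i ∧ ∀ q ∈ Icc 1 i, Fp i A l q ≤ Fp i A l (qplus i A l) :=
  Nat.sSup_mem (exists_argmax_Icc (Fp i A l) hi) ⟨i, fun _ hp => (mem_Icc.1 hp.1).2⟩

theorem Fp_lt_of_qplus_lt {i : ℕ} (hi : 1 ≤ i) (A : Arr) {l q : ℕ} (hq : q ≤ i)
    (h : qplus i A l < q) : Fp i A l q < Fp i A l (qplus i A l) := by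
  by_contra! hle
  have hmem := qplus_mem hi A l
  refine h.not_ge (le_csSup (⟨i, fun _ hp => (mem_Icc.1 hp.1).2⟩ : BddAbove _)
    ⟨mem_Icc.2 ⟨?_, hq⟩, fun r hr => (hmem.2 r hr).trans hle⟩)
  lia

theorem qminus_mem {n i : ℕ} (hin : i ≤ n) (A : Arr) (l : ℕ) :
    qminus n i A l ∈ Icc i n ∧ ∀ q ∈ Icc i n, Fm n i A l q ≤ Fm n i A l (qminus n i A l) :=
  Nat.sInf_mem (exists_argmax_Icc (Fm n i A l) hin)

theorem Fm_lt_of_lt_qminus {n i : ℕ} (hin : i ≤ n) (A : Arr) {l q : ℕ} (hq : i ≤ q)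
    (h : q < qminus n i A l) : Fm n i A l q < Fm n i A l (qminus n i A l) := by
  by_contra! hle
  have hmem := qminus_mem hin A l
  have hn := (mem_Icc.1 hmem.1).2
  exact h.not_ge (Nat.sInf_le
    ⟨mem_Icc.2 ⟨hq, by lia⟩, fun r hr => (hmem.2 r hr).trans hle⟩)

theorem Fp_eq (A : Arr) (l : ℕ) {i p : ℕ} (hp : p ≤ i) :
    Fp i A l p = ∑ j ∈ Icc 1 i, A j (l - 1) +
      (∑ j ∈ Icc p i, A j l - ∑ j ∈ Icc (p + 1) i, A j (l - 1)) := by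
  rw [Fp, ← sum_Icc_add_sum_Icc_succ (fun j => A j (l - 1)) (by lia : 1 ≤ p + 1) hp]
  ring

theorem Fm_eq (A : Arr) (l : ℕ) {n i p : ℕ} (hi : 1 ≤ i) (hip : i ≤ p) (hp : p ≤ n) :
    Fm n i A l p = ∑ j ∈ Icc i n, A (l + 1) j +
      (∑ j ∈ Icc i p, A l j - ∑ j ∈ Icc i (p - 1), A (l + 1) j) := by
  obtain ⟨p, rfl⟩ : ∃ r, p = r + 1 := ⟨p - 1, by lia⟩
  rw [Fm, ← sum_Icc_add_sum_Icc_succ (A (l + 1)) hip (by lia : p ≤ n), Nat.add_sub_cancel]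
  ring

theorem eps_eq_zero_of_eop_eq_none {n i m l : ℕ} {A : Arr} (h : eop n i m l A = none) :
    eps n i m l A = 0 := by
  by_contra hne
  simp [eop, hne] at h

theorem sum_le_of_eps_eq_zero_of_gt {n i m l : ℕ} {A : Arr} (hi : 1 ≤ i) (hl : i < l)
    (h : eps n i m l A = 0) {p : ℕ} (hp1 : 1 ≤ p) (hp : p ≤ i) :
    ∑ j ∈ Icc p i, A j l ≤ ∑ j ∈ Icc (p + 1) i, A j (l - 1) := by
  rw [eps, if_neg hl.ne', if_pos hl] at h
  have hmem := qplus_mem hi A l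
  have hle := hmem.2 p (mem_Icc.2 ⟨hp1, hp⟩)
  rw [Fp_eq A l hp, Fp_eq A l (mem_Icc.1 hmem.1).2] at hle
  lia

theorem sum_le_of_eps_eq_zero_of_lt {n i m l : ℕ} {A : Arr} (hi : 1 ≤ i) (hin : i ≤ n)
    (hl : l < i) (h : eps n i m l A = 0) {p : ℕ} (hp1 : i ≤ p) (hp : p ≤ n) :
    ∑ j ∈ Icc i p, A l j ≤ ∑ j ∈ Icc i (p - 1), A (l + 1) j := by
  rw [eps, if_neg hl.ne, if_neg hl.not_gt] at h
  have hmem := qminus_mem hin A l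
  have hle := hmem.2 p (mem_Icc.2 ⟨hp1, hp⟩)
  have hq := mem_Icc.1 hmem.1
  rw [Fm_eq A l hi hp1 hp, Fm_eq A l hi hq.1 hq.2] at hle
  lia

theorem IsNonnegOnBox.eq_zero_of_eop_eq_none {n i m : ℕ} (hi : 1 ≤ i) (hin : i ≤ n) {A : Arr}
    (hA : IsNonnegOnBox n i A) (h : ∀ l ∈ Icc 1 n, eop n i m l A = none) (p q : ℕ) :
    A p q = 0 := by
  have heps : ∀ l, 1 ≤ l → l ≤ n → eps n i m l A = 0 := fun l h1 h2 =>
    eps_eq_zero_of_eop_eq_none (h l (mem_Icc.2 ⟨h1, h2⟩))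
  by_cases hpq : 1 ≤ p ∧ p ≤ i ∧ i ≤ q ∧ q ≤ n
  swap
  · exact hA.2 p q hpq
  obtain ⟨hp1, hpi, hiq, hqn⟩ := hpq
  induction q, hiq using Nat.le_induction generalizing p with
  | base =>
    rcases hpi.eq_or_lt with rfl | hlt
    · simpa [eps] using heps p hp1 hqn
    · have hle := sum_le_of_eps_eq_zero_of_lt hi hin hlt (heps p hp1 (by lia)) le_rfl hin
      rw [Icc_self, sum_singleton, Icc_eq_empty (by lia), sum_empty] at hle
      exact le_antisymm hle (hA.nonneg p i)
  | succ q hiq ih =>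
    have hle := sum_le_of_eps_eq_zero_of_gt hi (by lia) (heps (q + 1) (by lia) hqn) le_rfl hi
    rw [Nat.add_sub_cancel, sum_eq_zero (s := Icc (1 + 1) i) fun j hj => ih j
      (by rw [mem_Icc] at hj; lia) (mem_Icc.1 hj).2 (by lia)] at hle
    have hz := le_antisymm hle (sum_nonneg fun j _ => hA.nonneg j (q + 1))
    exact (sum_eq_zero_iff_of_nonneg fun j _ => hA.nonneg j (q + 1)).1 hz p
      (mem_Icc.2 ⟨hp1, hpi⟩)

theorem entry_qplus_pos {n i m l : ℕ} {A : Arr} (hi : 1 ≤ i) (hA : IsNonnegOnBox n i A)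
    (hl : i < l) (h : eps n i m l A ≠ 0) : 0 < A (qplus i A l) l := by
  have hq := mem_Icc.1 (qplus_mem hi A l).1
  rcases hq.2.eq_or_lt with heq | hlt
  · rw [eps, if_neg hl.ne', if_pos hl, heq, Icc_self, sum_singleton,
      Icc_eq_empty (by lia), sum_empty, sub_zero] at h
    rw [heq]
    exact (hA.nonneg i l).lt_of_ne' h
  · have hF := Fp_lt_of_qplus_lt hi A (l := l) hlt (Nat.lt_succ_self _)
    have h1 := sum_Icc_succ_top (by lia : 1 ≤ qplus i A l + 1) (fun j => A j (l - 1))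
    have h2 := sum_Icc_add_sum_Icc_succ (fun j => A j l) (Nat.le_succ (qplus i A l)) hq.2
    have h3 := hA.nonneg (qplus i A l + 1) (l - 1)
    rw [Icc_self, sum_singleton] at h2
    simp only [Fp, Nat.succ_eq_add_one] at hF
    lia

theorem entry_qminus_pos {n i m l : ℕ} {A : Arr} (hi : 1 ≤ i) (hin : i ≤ n)
    (hA : IsNonnegOnBox n i A) (hl : l < i) (h : eps n i m l A ≠ 0) :
    0 < A l (qminus n i A l) := by
  have hq := mem_Icc.1 (qminus_mem hin A l).1
  rcases hq.1.eq_or_lt with heq | hlt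
  · rw [eps, if_neg hl.ne, if_neg hl.not_gt, ← heq, Icc_self, sum_singleton,
      Icc_eq_empty (by lia), sum_empty, sub_zero] at h
    rw [← heq]
    exact (hA.nonneg l i).lt_of_ne' h
  · obtain ⟨r, hr⟩ : ∃ r, qminus n i A l = r + 1 := ⟨qminus n i A l - 1, by lia⟩
    have hF := Fm_lt_of_lt_qminus hin A (l := l) (q := r) (by lia) (by lia)
    rw [hr] at hq hF ⊢
    have h1 := sum_Icc_succ_top hq.1 (A l)
    have h2 := sum_Icc_add_sum_Icc_succ (A (l + 1)) (Nat.le_succ r) (by lia : r ≤ n)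
    have h3 := hA.nonneg (l + 1) r
    rw [Icc_self, sum_singleton] at h2
    simp only [Fm] at hF
    lia

theorem IsNonnegOnBox.eop {n i m l : ℕ} (hi : 1 ≤ i) (hin : i ≤ n) (hl : l ∈ Icc 1 n)
    {A B : Arr} (hA : IsNonnegOnBox n i A) (h : KR.eop n i m l A = some B) :
    IsNonnegOnBox n i B ∧ height n i B = height n i A - 1 := by
  rw [mem_Icc] at hl
  by_cases he : eps n i m l A = 0
  · simp [KR.eop, he] at h
  rw [KR.eop, if_neg he, Option.some_inj] at h
  subst h
  rcases lt_trichotomy l i with hlt | rfl | hgt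
  · rw [if_neg hlt.ne, if_neg hlt.not_gt]
    have hpos := entry_qminus_pos hi hin hA hlt he
    have hq := mem_Icc.1 (qminus_mem hin A l).1
    refine ⟨(hA.upd ⟨hl.1, hlt.le⟩ hq (by lia)).upd ⟨by lia, hlt⟩ hq
      (by have := hA.nonneg (l + 1) (qminus n i A l); lia), ?_⟩
    rw [height_upd _ _ ⟨by lia, hlt⟩ hq, height_upd _ _ ⟨hl.1, hlt.le⟩ hq]
    simp only [KR.upd, Nat.succ_ne_self, false_and, if_false]
    push_cast
    ring
  · rw [if_pos rfl]
    rw [eps, if_pos rfl] at he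
    have := hA.nonneg l l
    refine ⟨hA.upd ⟨hi, le_rfl⟩ ⟨le_rfl, hin⟩ (by lia), ?_⟩
    rw [height_upd _ _ ⟨hi, le_rfl⟩ ⟨le_rfl, hin⟩]
    ring
  · rw [if_neg hgt.ne', if_pos hgt]
    have hpos := entry_qplus_pos hi hA hgt he
    have hq := mem_Icc.1 (qplus_mem hi A l).1
    obtain ⟨l, rfl⟩ : ∃ k, l = k + 1 := ⟨l - 1, by lia⟩
    rw [Nat.add_sub_cancel]
    have hl' : i ≤ l ∧ l ≤ n := by lia
    have hl'' : i ≤ l + 1 ∧ l + 1 ≤ n := by lia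
    refine ⟨(hA.upd hq hl' (by have := hA.nonneg (qplus i A (l + 1)) l; lia)).upd hq hl''
      (by lia), ?_⟩
    rw [height_upd _ _ hq hl'', height_upd _ _ hq hl']
    simp only [KR.upd, Nat.succ_ne_self, and_false, if_false]
    push_cast
    ring

theorem IsNonnegOnBox.exists_foldl_eop_eq_zero {n i : ℕ} (m : ℕ) (hi : 1 ≤ i) (hin : i ≤ n)
    {A : Arr} (hA : IsNonnegOnBox n i A) : ∃ L : List ℕ, (∀ l ∈ L, l ∈ Icc 1 n) ∧
      L.foldl (fun o l => Option.bind o (KR.eop n i m l)) (some A) =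
        some (fun _ _ => (0 : ℤ)) := by
  induction hk : (height n i A).toNat using Nat.strong_induction_on generalizing A with
  | _ k ih =>
    by_cases hall : ∀ l ∈ Icc 1 n, KR.eop n i m l A = none
    · refine ⟨[], by simp, ?_⟩
      rw [List.foldl_nil, Option.some_inj]
      funext p q
      exact hA.eq_zero_of_eop_eq_none hi hin hall p q
    · push Not at hall
      obtain ⟨l, hl, hne⟩ := hall
      obtain ⟨B, hB⟩ := Option.ne_none_iff_exists'.1 hne
      obtain ⟨hBnn, hBh⟩ := hA.eop hi hin hl hB
      have := height_nonneg hBnn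
      obtain ⟨L, hL, hfold⟩ := ih _ (by lia) hBnn rfl
      refine ⟨l :: L, List.forall_mem_cons.2 ⟨hl, hL⟩, ?_⟩
      rw [List.foldl_cons, Option.bind_some, hB, hfold]

/-- If `e_l A = 0` for all `l`, then `A` is the all-zero array;
consequently every `A ∈ B^{m,i}` can be brought to the all-zero array by a sequence
of raising operators, so the crystal graph of `B^{m,i}` is connected. -/
theorem stmt8 (n i m : ℕ) (hi : 1 ≤ i) (hin : i ≤ n) :
    (∀ A : Arr, InB n i m A → (∀ l ∈ Finset.Icc 1 n, eop n i m l A = none) →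
      ∀ p q, 1 ≤ p → p ≤ i → i ≤ q → q ≤ n → A p q = 0) ∧
    (∀ A : Arr, InB n i m A → ∃ L : List ℕ, (∀ l ∈ L, l ∈ Finset.Icc 1 n) ∧
      L.foldl (fun o l => Option.bind o (eop n i m l)) (some A) =
        some (fun _ _ => (0 : ℤ))) := by
  exact ⟨fun A hA h p q _ _ _ _ => IsNonnegOnBox.eq_zero_of_eop_eq_none hi hin ⟨hA.1, hA.2.1⟩ h p q,
    fun A hA => IsNonnegOnBox.exists_foldl_eop_eq_zero m hi hin ⟨hA.1, hA.2.1⟩⟩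

end KR
end

section
/- B^{m,i} satisfies the third Stembridge axiom: for every A ∈ B^{m,i} and l, j ∈ {1,…,n} with j ≠ l, if e_l A ≠ 0, e_j A ≠ 0 and ε_j(A) − ε_j(e_l A) = ε_l(A) − ε_l(e_j A) = −1, then e_l e_j e_j e_l A = e_j e_l e_l e_j A ≠ 0 and, writing A' for this common element, φ_l(A') − φ_l(f_j A') = φ_j(A') − φ_j(f_l A') = −1. -/
open Finset

namespace KR

/-- `q` is the `pos`-last maximizer of `g` on `S`. -/
def LastMax (pos : ℕ → ℤ) (S : Finset ℕ) (g : ℕ → ℤ) (q : ℕ) : Prop :=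
  q ∈ S ∧ ∀ p ∈ S, g p ≤ g q ∧ (pos q < pos p → g p < g q)

theorem LastMax.congr {pos : ℕ → ℤ} {S : Finset ℕ} {g g' : ℕ → ℤ} {q : ℕ}
    (h : LastMax pos S g q) (hg : ∀ p ∈ S, g' p = g p) : LastMax pos S g' q := by
  refine ⟨h.1, fun p hp => ?_⟩
  rw [hg p hp, hg q h.1]
  exact h.2 p hp

theorem exists_lastMax (pos : ℕ → ℤ) (S : Finset ℕ) (hS : S.Nonempty) (g : ℕ → ℤ) :
    ∃ q, LastMax pos S g q := by
  obtain ⟨q₀, hq₀, hmax⟩ := S.exists_max_image g hS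
  obtain ⟨q, hq, hlast⟩ := (S.filter fun p => g p = g q₀).exists_max_image pos
    ⟨q₀, by simp [hq₀]⟩
  simp only [mem_filter] at hq hlast
  refine ⟨q, hq.1, fun p hp => ⟨by rw [hq.2]; exact hmax p hp, fun hlt => ?_⟩⟩
  have h1 := hmax p hp
  by_contra hcon
  have := hlast p ⟨hp, by omega⟩
  omega

/-- Effect on the `l`-signature of applying `e_l` at position `q`. -/
def selfEff (pos : ℕ → ℤ) (q p : ℕ) : ℤ :=
  if pos p < pos q then -2 else if pos p ≤ pos q then -1 else 0

/-- Indicator of the positions strictly before `q`. -/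
def ltEff (pos : ℕ → ℤ) (q p : ℕ) : ℤ := if pos p < pos q then 1 else 0

/-- Indicator of the positions weakly before `q`. -/
def leEff (pos : ℕ → ℤ) (q p : ℕ) : ℤ := if pos p ≤ pos q then 1 else 0

theorem signature_paths (pos : ℕ → ℤ) (S T : Finset ℕ) (g h : ℕ → ℤ) (q r : ℕ)
    (hq : LastMax pos S g q) (hr : LastMax pos T h r)
    (hT : ∃ t ∈ T, pos t < pos q ∧ h t = h r) (hS : ∃ t ∈ S, pos t ≤ pos r ∧ g t = g q) :
    ∃ r₁ r₂ s q₁ q₂ t,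
      LastMax pos T (fun p => h p + ltEff pos q p) r₁ ∧
      h r₁ + ltEff pos q r₁ = h r + 1 ∧
      LastMax pos T (fun p => h p + ltEff pos q p + selfEff pos r₁ p) r₂ ∧
      h r₂ + ltEff pos q r₂ + selfEff pos r₁ r₂ = h r ∧
      LastMax pos S (fun p => g p + selfEff pos q p + leEff pos r₁ p + leEff pos r₂ p) s ∧
      g s + selfEff pos q s + leEff pos r₁ s + leEff pos r₂ s = g q ∧
      LastMax pos S (fun p => g p + leEff pos r p) q₁ ∧
      g q₁ + leEff pos r q₁ = g q + 1 ∧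
      LastMax pos S (fun p => g p + leEff pos r p + selfEff pos q₁ p) q₂ ∧
      g q₂ + leEff pos r q₂ + selfEff pos q₁ q₂ = g q ∧
      LastMax pos T (fun p => h p + selfEff pos r p + ltEff pos q₁ p + ltEff pos q₂ p) t ∧
      h t + selfEff pos r t + ltEff pos q₁ t + ltEff pos q₂ t = h r ∧
      (q₁ = q ∧ q₂ = s ∨ q₁ = s ∧ q₂ = q) ∧ (r₁ = r ∧ r₂ = t ∨ r₁ = t ∧ r₂ = r) := by
  obtain ⟨hqS, hqm⟩ := hq
  obtain ⟨hrT, hrm⟩ := hr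
  obtain ⟨t₀, ht₀, ht₀q, ht₀h⟩ := hT
  obtain ⟨s₀, hs₀, hs₀r, hs₀g⟩ := hS
  rcases le_or_gt (pos q) (pos r) with hqr | hqr
  · obtain ⟨r₁, hr₁, hr₁m⟩ := exists_lastMax pos T ⟨r, hrT⟩ (fun p => h p + ltEff pos q p)
    have a1 := (hr₁m t₀ ht₀).1
    have a2 := (hrm r₁ hr₁).1
    have b1 : pos r₁ < pos q ∧ h r₁ = h r := by
      simp only [ltEff] at a1
      split_ifs at a1 <;> omega
    obtain ⟨s, hs, hsm⟩ := exists_lastMax pos S ⟨q, hqS⟩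
      (fun p => g p + selfEff pos q p + leEff pos r₁ p + leEff pos r p)
    have a3 := (hsm q hqS)
    have a4 := hqm s hs
    have b2 : pos q ≤ pos s ∧ pos s ≤ pos r ∧
        g s + selfEff pos q s + leEff pos r₁ s + leEff pos r s = g q := by
      simp only [selfEff, leEff] at a3 ⊢
      split_ifs at a3 ⊢ <;> omega
    refine ⟨r₁, r, s, q, s, r₁, ⟨hr₁, hr₁m⟩, ?_, ⟨hrT, fun p hp => ?_⟩, ?_, ⟨hs, hsm⟩, b2.2.2,
      ⟨hqS, fun p hp => ?_⟩, ?_, ⟨hs, fun p hp => ?_⟩, ?_, ⟨hr₁, fun p hp => ?_⟩, ?_,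
      .inl ⟨rfl, rfl⟩, .inr ⟨rfl, rfl⟩⟩
    all_goals try have c1 := hrm p (by assumption)
    all_goals try have c2 := hqm p (by assumption)
    all_goals try have c3 := hsm p (by assumption)
    all_goals try have c4 := hr₁m p (by assumption)
    all_goals simp only [selfEff, leEff, ltEff] at *
    all_goals grind
  · obtain ⟨q₁, hq₁, hq₁m⟩ := exists_lastMax pos S ⟨q, hqS⟩ (fun p => g p + leEff pos r p)
    have a1 := (hq₁m s₀ hs₀).1
    have a2 := (hqm q₁ hq₁).1
    have b1 : pos q₁ ≤ pos r ∧ g q₁ = g q := by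
      simp only [leEff] at a1
      split_ifs at a1 <;> omega
    obtain ⟨t, ht, htm⟩ := exists_lastMax pos T ⟨r, hrT⟩
      (fun p => h p + ltEff pos q p + selfEff pos r p)
    have a3 := htm r hrT
    have a4 := hrm t ht
    have b2 : pos r ≤ pos t ∧ pos t < pos q ∧
        h t + ltEff pos q t + selfEff pos r t = h r := by
      simp only [selfEff, ltEff] at a3 ⊢
      split_ifs at a3 ⊢ <;> omega
    refine ⟨r, t, q₁, q₁, q, t, ⟨hrT, fun p hp => ?_⟩, ?_, ⟨ht, htm⟩, b2.2.2,
      ⟨hq₁, fun p hp => ?_⟩, ?_, ⟨hq₁, hq₁m⟩, ?_, ⟨hqS, fun p hp => ?_⟩, ?_,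
      ⟨ht, fun p hp => ?_⟩, ?_, .inr ⟨rfl, rfl⟩, .inl ⟨rfl, rfl⟩⟩
    all_goals try have c1 := hrm p (by assumption)
    all_goals try have c2 := hqm p (by assumption)
    all_goals try have c3 := htm p (by assumption)
    all_goals try have c4 := hq₁m p (by assumption)
    all_goals simp only [selfEff, leEff, ltEff] at *
    all_goals grind

/-- The positions at which `e_l` and `f_l` can act. -/
def dom (n i l : ℕ) : Finset ℕ := if l = i then {i} else if i < l then Icc 1 i else Icc i n

/-- The `l`-signature of an array: its maximum over `dom n i l` is `ε_l`. -/
def sig (i l : ℕ) (A : Arr) (p : ℕ) : ℤ :=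
  if l = i then A i i
  else if i < l then ∑ k ∈ Icc p i, A k l - ∑ k ∈ Icc (p + 1) i, A k (l - 1)
  else ∑ k ∈ Icc i p, A l k - ∑ k ∈ Icc i (p - 1), A (l + 1) k

/-- The array added by `e_l` when it acts at position `q`. -/
def shift (i l q : ℕ) : Arr := fun a b =>
  if l = i then (if a = i ∧ b = i then -1 else 0)
  else if i < l then (if a = q then (if b = l then -1 else if b = l - 1 then 1 else 0) else 0)
  else (if b = q then (if a = l then -1 else if a = l + 1 then 1 else 0) else 0)

/-- The difference `φ_l - ε_l`. -/
def wtl (n i m l : ℕ) (A : Arr) : ℤ :=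
  if l = i then (m : ℤ) - ∑ k ∈ Icc 1 (i - 1), A k i - ∑ k ∈ Icc i n, A i k - A i i
  else if i < l then ∑ k ∈ Icc 1 i, A k (l - 1) - ∑ k ∈ Icc 1 i, A k l
  else ∑ k ∈ Icc i n, A (l + 1) k - ∑ k ∈ Icc i n, A l k

/-- `pos` lists the positions of `dom n i l` in the order in which `e_l` reads them. -/
def Reads (pos : ℕ → ℤ) (i l : ℕ) : Prop :=
  (i < l → pos = fun p : ℕ => (p : ℤ)) ∧ (l < i → pos = fun p : ℕ => -(p : ℤ))

theorem sum_Icc_split (x : ℕ → ℤ) {a p b : ℕ} (ha : 1 ≤ a) (hap : a ≤ p) (hpb : p ≤ b) :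
    ∑ k ∈ Icc a (p - 1), x k + ∑ k ∈ Icc p b, x k = ∑ k ∈ Icc a b, x k := by
  rw [← sum_union]
  · congr 1
    ext k
    simp only [mem_union, mem_Icc]
    omega
  · rw [disjoint_left]
    intro k
    simp only [mem_Icc]
    omega

theorem sum_Icc_split' (x : ℕ → ℤ) {a p b : ℕ} (hap : a ≤ p) (hpb : p ≤ b) :
    ∑ k ∈ Icc a p, x k + ∑ k ∈ Icc (p + 1) b, x k = ∑ k ∈ Icc a b, x k := by
  rw [← sum_union]
  · congr 1
    ext k
    simp only [mem_union, mem_Icc]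
    omega
  · rw [disjoint_left]
    intro k
    simp only [mem_Icc]
    omega

theorem Fp_eq_sig {i l p : ℕ} (hil : i < l) (A : Arr) (hp : p ∈ Icc 1 i) :
    Fp i A l p = sig i l A p + ∑ k ∈ Icc 1 i, A k (l - 1) := by
  rw [mem_Icc] at hp
  have := sum_Icc_split' (fun k => A k (l - 1)) hp.1 hp.2
  simp only [Fp, sig, if_neg hil.ne', if_pos hil]
  linarith

theorem Fm_eq_sig {n i l p : ℕ} (hi : 1 ≤ i) (hil : l < i) (A : Arr) (hp : p ∈ Icc i n) :
    Fm n i A l p = sig i l A p + ∑ k ∈ Icc i n, A (l + 1) k := by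
  rw [mem_Icc] at hp
  have := sum_Icc_split (fun k => A (l + 1) k) hi hp.1 hp.2
  simp only [Fm, sig, if_neg hil.ne, if_neg hil.not_gt]
  linarith

theorem qplus_eq {n i l q : ℕ} (hil : i < l) {A : Arr}
    (h : LastMax (fun p => (p : ℤ)) (dom n i l) (sig i l A) q) : qplus i A l = q := by
  rw [dom, if_neg hil.ne', if_pos hil] at h
  refine IsGreatest.csSup_eq ⟨⟨h.1, fun p hp => ?_⟩, fun p hp => ?_⟩
  · rw [Fp_eq_sig hil A hp, Fp_eq_sig hil A h.1]
    linarith [(h.2 p hp).1]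
  · have h1 := hp.2 q h.1
    rw [Fp_eq_sig hil A hp.1, Fp_eq_sig hil A h.1] at h1
    by_contra hcon
    have := (h.2 p hp.1).2 (by simpa using hcon)
    linarith

theorem qminus_eq {n i l q : ℕ} (hi : 1 ≤ i) (hil : l < i) {A : Arr}
    (h : LastMax (fun p => -(p : ℤ)) (dom n i l) (sig i l A) q) : qminus n i A l = q := by
  rw [dom, if_neg hil.ne, if_neg hil.not_gt] at h
  refine IsLeast.csInf_eq ⟨⟨h.1, fun p hp => ?_⟩, fun p hp => ?_⟩
  · rw [Fm_eq_sig hi hil A hp, Fm_eq_sig hi hil A h.1]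
    linarith [(h.2 p hp).1]
  · have h1 := hp.2 q h.1
    rw [Fm_eq_sig hi hil A hp.1, Fm_eq_sig hi hil A h.1] at h1
    by_contra hcon
    have := (h.2 p hp.1).2 (by simpa using hcon)
    linarith

theorem pplus_eq {n i l q : ℕ} (hil : i < l) {A : Arr}
    (h : LastMax (fun p => -(p : ℤ)) (dom n i l) (sig i l A) q) : pplus i A l = q := by
  rw [dom, if_neg hil.ne', if_pos hil] at h
  refine IsLeast.csInf_eq ⟨⟨h.1, fun p hp => ?_⟩, fun p hp => ?_⟩
  · rw [Fp_eq_sig hil A hp, Fp_eq_sig hil A h.1]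
    linarith [(h.2 p hp).1]
  · have h1 := hp.2 q h.1
    rw [Fp_eq_sig hil A hp.1, Fp_eq_sig hil A h.1] at h1
    by_contra hcon
    have := (h.2 p hp.1).2 (by simpa using hcon)
    linarith

theorem pminus_eq {n i l q : ℕ} (hi : 1 ≤ i) (hil : l < i) {A : Arr}
    (h : LastMax (fun p => (p : ℤ)) (dom n i l) (sig i l A) q) : pminus n i A l = q := by
  rw [dom, if_neg hil.ne, if_neg hil.not_gt] at h
  refine IsGreatest.csSup_eq ⟨⟨h.1, fun p hp => ?_⟩, fun p hp => ?_⟩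
  · rw [Fm_eq_sig hi hil A hp, Fm_eq_sig hi hil A h.1]
    linarith [(h.2 p hp).1]
  · have h1 := hp.2 q h.1
    rw [Fm_eq_sig hi hil A hp.1, Fm_eq_sig hi hil A h.1] at h1
    by_contra hcon
    have := (h.2 p hp.1).2 (by simpa using hcon)
    linarith

theorem dom_nonempty {n i : ℕ} (hi : 1 ≤ i) (hin : i ≤ n) (l : ℕ) : (dom n i l).Nonempty := by
  refine ⟨i, ?_⟩
  unfold dom
  split_ifs <;> simp [hi, hin]

theorem eps_eq {n i m l q : ℕ} {pos : ℕ → ℤ} (hi : 1 ≤ i) (hpos : Reads pos i l) {A : Arr}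
    (h : LastMax pos (dom n i l) (sig i l A) q) : eps n i m l A = sig i l A q := by
  rcases lt_trichotomy l i with hl | rfl | hl
  · obtain rfl := hpos.2 hl
    simp only [eps, sig, if_neg hl.ne, if_neg hl.not_gt, qminus_eq hi hl h]
  · simp [eps, sig]
  · obtain rfl := hpos.1 hl
    simp only [eps, sig, if_neg hl.ne', if_pos hl, qplus_eq hl h]

theorem eop_eq {n i m l q : ℕ} {pos : ℕ → ℤ} (hi : 1 ≤ i) (hpos : Reads pos i l) {A : Arr}
    (h : LastMax pos (dom n i l) (sig i l A) q) (h0 : sig i l A q ≠ 0) :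
    eop n i m l A = some (A + shift i l q) := by
  rw [eop, if_neg (by rwa [eps_eq hi hpos h])]
  congr 1
  rcases lt_trichotomy l i with hl | rfl | hl
  · obtain rfl := hpos.2 hl
    rw [if_neg hl.ne, if_neg hl.not_gt, qminus_eq hi hl h]
    funext a b
    simp only [upd, shift, Pi.add_apply, if_neg hl.ne, if_neg hl.not_gt]
    grind
  · rw [if_pos rfl]
    funext a b
    simp only [upd, shift, Pi.add_apply]
    grind
  · obtain rfl := hpos.1 hl
    rw [if_neg hl.ne', if_pos hl, qplus_eq hl h]
    funext a b
    simp only [upd, shift, Pi.add_apply, if_neg hl.ne', if_pos hl]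
    grind

theorem phi_eq {n i m l : ℕ} (hi : 1 ≤ i) (hin : i ≤ n) (A : Arr) :
    phi n i m l A = eps n i m l A + wtl n i m l A := by
  rcases lt_trichotomy l i with hl | rfl | hl
  · obtain ⟨q, hq⟩ := exists_lastMax (fun p => -(p : ℤ)) _ (dom_nonempty hi hin l) (sig i l A)
    obtain ⟨p, hp⟩ := exists_lastMax (fun p => (p : ℤ)) _ (dom_nonempty hi hin l) (sig i l A)
    have hpq := le_antisymm (hp.2 q hq.1).1 (hq.2 p hp.1).1
    rw [eps_eq hi ⟨fun h => absurd h hl.not_gt, fun _ => rfl⟩ hq, hpq]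
    have hp' := hp.1
    rw [dom, if_neg hl.ne, if_neg hl.not_gt, mem_Icc] at hp'
    have e1 := sum_Icc_split (fun k => A (l + 1) k) hi hp'.1 hp'.2
    have e2 := sum_Icc_split' (fun k => A l k) hp'.1 hp'.2
    simp only [phi, sig, wtl, if_neg hl.ne, if_neg hl.not_gt, pminus_eq hi hl hp]
    linarith
  · simp [phi, eps, wtl]
  · obtain ⟨q, hq⟩ := exists_lastMax (fun p => (p : ℤ)) _ (dom_nonempty hi hin l) (sig i l A)
    obtain ⟨p, hp⟩ := exists_lastMax (fun p => -(p : ℤ)) _ (dom_nonempty hi hin l) (sig i l A)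
    have hpq := le_antisymm (hp.2 q hq.1).1 (hq.2 p hp.1).1
    rw [eps_eq hi ⟨fun _ => rfl, fun h => absurd h hl.not_gt⟩ hq, hpq]
    have hp' := hp.1
    rw [dom, if_neg hl.ne', if_pos hl, mem_Icc] at hp'
    have e1 := sum_Icc_split (fun k => A k l) le_rfl hp'.1 hp'.2
    have e2 := sum_Icc_split' (fun k => A k (l - 1)) hp'.1 hp'.2
    simp only [phi, sig, wtl, if_neg hl.ne', if_pos hl, pplus_eq hl hp]
    linarith

theorem shift_self (i q a b : ℕ) : shift i i q a b = if a = i ∧ b = i then -1 else 0 := by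
  simp [shift]

theorem shift_gt {i l : ℕ} (hl : i < l) (q a b : ℕ) : shift i l q a b =
    if a = q then (if b = l then -1 else if b = l - 1 then 1 else 0) else 0 := by
  simp [shift, hl, hl.ne']

theorem shift_lt {i l : ℕ} (hl : l < i) (q a b : ℕ) : shift i l q a b =
    if b = q then (if a = l then -1 else if a = l + 1 then 1 else 0) else 0 := by
  simp [shift, hl.not_gt, hl.ne]

theorem sig_self (i : ℕ) (A : Arr) (p : ℕ) : sig i i A p = A i i := by simp [sig]

theorem sig_gt {i l : ℕ} (hl : i < l) (A : Arr) (p : ℕ) : sig i l A p =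
    ∑ k ∈ Icc p i, A k l - ∑ k ∈ Icc (p + 1) i, A k (l - 1) := by
  simp [sig, hl, hl.ne']

theorem sig_lt {i l : ℕ} (hl : l < i) (A : Arr) (p : ℕ) : sig i l A p =
    ∑ k ∈ Icc i p, A l k - ∑ k ∈ Icc i (p - 1), A (l + 1) k := by
  simp [sig, hl.not_gt, hl.ne]

theorem sig_add (i l : ℕ) (A B : Arr) (p : ℕ) :
    sig i l (A + B) p = sig i l A p + sig i l B p := by
  simp only [sig, Pi.add_apply, sum_add_distrib]
  split_ifs <;> ring

theorem sig_shift_same {n i l p q : ℕ} {pos : ℕ → ℤ} (hi : 1 ≤ i) (hpos : Reads pos i l)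
    (hq : q ∈ dom n i l) (hp : p ∈ dom n i l) :
    sig i l (shift i l q) p = selfEff pos q p := by
  rcases lt_trichotomy l i with hl | rfl | hl
  · obtain rfl := hpos.2 hl
    rw [dom, if_neg hl.ne, if_neg hl.not_gt, mem_Icc] at hp hq
    simp only [sig_lt hl, shift_lt hl, sum_ite_eq', mem_Icc, selfEff]
    grind
  · simp only [dom, if_true, mem_singleton] at hp hq
    subst hp hq
    simp [sig, shift, selfEff]
  · obtain rfl := hpos.1 hl
    rw [dom, if_neg hl.ne', if_pos hl, mem_Icc] at hp hq
    simp only [sig_gt hl, shift_gt hl, sum_ite_eq', mem_Icc, selfEff]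
    grind

theorem wtl_add_shift_same {n i m l q : ℕ} (hi : 1 ≤ i) (hin : i ≤ n) (A : Arr)
    (hq : q ∈ dom n i l) : wtl n i m l (A + shift i l q) = wtl n i m l A + 2 := by
  rcases lt_trichotomy l i with hl | rfl | hl
  · rw [dom, if_neg hl.ne, if_neg hl.not_gt, mem_Icc] at hq
    simp only [wtl, if_neg hl.ne, if_neg hl.not_gt, Pi.add_apply, sum_add_distrib,
      shift_lt hl, sum_ite_eq', mem_Icc]
    grind
  · have h1 : ∀ k ∈ Icc 1 (l - 1), (A + shift l l q) k l = A k l := by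
      intro k hk
      rw [mem_Icc] at hk
      simp only [Pi.add_apply, shift_self]
      grind
    have h2 : ∀ k, shift l l q l k = if k = l then -1 else 0 := by
      intro k
      simp [shift_self]
    simp only [wtl, if_true]
    rw [sum_congr rfl h1]
    simp only [Pi.add_apply, sum_add_distrib, h2, sum_ite_eq', mem_Icc]
    grind
  · rw [dom, if_neg hl.ne', if_pos hl, mem_Icc] at hq
    simp only [wtl, if_neg hl.ne', if_pos hl, Pi.add_apply, sum_add_distrib,
      shift_gt hl, sum_ite_eq', mem_Icc]
    grind

theorem fop_eq {n i m l q : ℕ} {pos : ℕ → ℤ} (hi : 1 ≤ i) (hpos : Reads pos i l) {A : Arr}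
    (h : LastMax pos (dom n i l) (sig i l A) q) (h0 : phi n i m l (A + shift i l q) ≠ 0) :
    fop n i m l (A + shift i l q) = some A := by
  have key : LastMax (fun p => -pos p) (dom n i l) (sig i l (A + shift i l q)) q := by
    refine ⟨h.1, fun p hp => ?_⟩
    have := h.2 p hp
    rw [sig_add, sig_add, sig_shift_same hi hpos h.1 hp, sig_shift_same hi hpos h.1 h.1]
    simp only [selfEff]
    grind
  rw [fop, if_neg h0]
  congr 1
  rcases lt_trichotomy l i with hl | rfl | hl
  · obtain rfl := hpos.2 hl
    simp only [neg_neg] at key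
    rw [if_neg hl.ne, if_neg hl.not_gt, pminus_eq hi hl key]
    funext a b
    simp only [upd, Pi.add_apply, shift_lt hl]
    grind
  · rw [if_pos rfl]
    funext a b
    simp only [upd, shift_self, Pi.add_apply]
    grind
  · obtain rfl := hpos.1 hl
    rw [if_neg hl.ne', if_pos hl, pplus_eq hl key]
    funext a b
    simp only [upd, Pi.add_apply, shift_gt hl]
    grind

theorem eps_add_shift_same {n i m l q : ℕ} {pos : ℕ → ℤ} (hi : 1 ≤ i) (hin : i ≤ n)
    (hpos : Reads pos i l) {A : Arr} (h : LastMax pos (dom n i l) (sig i l A) q) :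
    eps n i m l (A + shift i l q) = sig i l A q - 1 := by
  obtain ⟨u, hu⟩ := exists_lastMax pos _ (dom_nonempty hi hin l) (sig i l (A + shift i l q))
  rw [eps_eq hi hpos hu]
  have h1 := (hu.2 q h.1).1
  have h2 := h.2 u hu.1
  rw [sig_add, sig_add, sig_shift_same hi hpos h.1 hu.1, sig_shift_same hi hpos h.1 h.1] at h1
  rw [sig_add, sig_shift_same hi hpos h.1 hu.1]
  simp only [selfEff] at *
  grind

/-- How `e_l` and `e_j` act on each other's signatures for neighbouring nodes `l` and `j`. -/
structure Linked (n i m : ℕ) (pos : ℕ → ℤ) (l j : ℕ) : Prop where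
  sig_right : ∀ q ∈ dom n i l, ∀ p ∈ dom n i j, sig i j (shift i l q) p = ltEff pos q p
  sig_left : ∀ r ∈ dom n i j, ∀ p ∈ dom n i l, sig i l (shift i j r) p = leEff pos r p
  wt_right : ∀ A : Arr, ∀ q ∈ dom n i l,
    wtl n i m j (A + shift i l q) = wtl n i m j A - 1
  wt_left : ∀ A : Arr, ∀ r ∈ dom n i j,
    wtl n i m l (A + shift i j r) = wtl n i m l A - 1

theorem linked_above {n i l : ℕ} (m : ℕ) (hi : 1 ≤ i) (hil : i ≤ l) (hln : l + 1 ≤ n) :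
    Linked n i m (fun p : ℕ => (p : ℤ)) l (l + 1) := by
  have hl1 : i < l + 1 := by omega
  rcases hil.eq_or_lt with rfl | hl
  · refine ⟨fun q hq p hp => ?_, fun q hq p hp => ?_, fun A q hq => ?_, fun A q hq => ?_⟩
    · simp only [dom, if_true, if_neg hl1.ne', if_pos hl1, mem_Icc, mem_singleton] at hp hq
      subst hq
      have e1 : ∀ k, shift q q q k (q + 1) = 0 := by simp [shift_self]
      have e2 : ∀ k, shift q q q k q = if k = q then -1 else 0 := by simp [shift_self]
      simp only [sig_gt hl1, Nat.add_sub_cancel, e1, e2, sum_ite_eq', mem_Icc, ltEff,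
        sum_const_zero]
      grind
    · simp only [dom, if_true, if_neg hl1.ne', if_pos hl1, mem_Icc, mem_singleton] at hp hq
      subst hp
      simp only [sig_self, shift_gt hl1, leEff]
      grind
    · simp only [dom, if_true, mem_singleton] at hq
      subst hq
      have e1 : ∀ k, shift q q q k (q + 1) = 0 := by simp [shift_self]
      have e2 : ∀ k, shift q q q k q = if k = q then -1 else 0 := by simp [shift_self]
      simp only [wtl, if_neg hl1.ne', if_pos hl1, Nat.add_sub_cancel, Pi.add_apply,
        sum_add_distrib, e1, e2, sum_ite_eq', mem_Icc, sum_const_zero]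
      grind
    · simp only [dom, if_neg hl1.ne', if_pos hl1, mem_Icc] at hq
      have e2 : ∀ k, shift i (i + 1) q k i = if k = q then 1 else 0 := by
        intro k; simp [shift_gt hl1]
      have e3 : ∀ k ∈ Icc i n, shift i (i + 1) q i k =
          (if k = i then if q = i then 1 else 0 else 0) -
            if k = i + 1 then if q = i then 1 else 0 else 0 := by
        intro k hk
        simp only [shift_gt hl1]
        grind
      simp only [wtl, if_true, Pi.add_apply, sum_add_distrib]
      rw [sum_congr rfl e3]
      simp only [e2, sum_sub_distrib, sum_ite_eq', mem_Icc]
      grind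
  · refine ⟨fun q hq p hp => ?_, fun q hq p hp => ?_, fun A q hq => ?_, fun A q hq => ?_⟩
    · simp only [dom, if_neg hl.ne', if_pos hl, if_neg hl1.ne', if_pos hl1, mem_Icc] at hp hq
      simp only [sig_gt hl1, shift_gt hl, Nat.add_sub_cancel, sum_ite_eq', mem_Icc, ltEff]
      grind
    · simp only [dom, if_neg hl.ne', if_pos hl, if_neg hl1.ne', if_pos hl1, mem_Icc] at hp hq
      simp only [sig_gt hl, shift_gt hl1, Nat.add_sub_cancel, sum_ite_eq', mem_Icc, leEff]
      grind
    · simp only [dom, if_neg hl.ne', if_pos hl, mem_Icc] at hq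
      simp only [wtl, if_neg hl1.ne', if_pos hl1, Pi.add_apply, sum_add_distrib,
        shift_gt hl, sum_ite_eq', mem_Icc, Nat.add_sub_cancel]
      grind
    · simp only [dom, if_neg hl1.ne', if_pos hl1, mem_Icc] at hq
      simp only [wtl, if_neg hl.ne', if_pos hl, Pi.add_apply, sum_add_distrib,
        shift_gt hl1, sum_ite_eq', mem_Icc, Nat.add_sub_cancel]
      grind

theorem linked_below {n i l : ℕ} (m : ℕ) (hin : i ≤ n) (hl0 : 1 ≤ l) (hli : l + 1 ≤ i) :
    Linked n i m (fun p : ℕ => -(p : ℤ)) (l + 1) l := by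
  have hl : l < i := by omega
  rcases hli.eq_or_lt with rfl | hl1
  · refine ⟨fun q hq p hp => ?_, fun q hq p hp => ?_, fun A q hq => ?_, fun A q hq => ?_⟩
    · simp only [dom, if_true, if_neg hl.ne, if_neg hl.not_gt, mem_Icc, mem_singleton] at hp hq
      subst hq
      have e1 : ∀ k, shift (l + 1) (l + 1) (l + 1) l k = 0 := by simp [shift_self]
      have e2 : ∀ k, shift (l + 1) (l + 1) (l + 1) (l + 1) k = if k = l + 1 then -1 else 0 := by
        simp [shift_self]
      simp only [sig_lt hl, e1, e2, sum_ite_eq', mem_Icc, ltEff, sum_const_zero]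
      grind
    · simp only [dom, if_true, if_neg hl.ne, if_neg hl.not_gt, mem_Icc, mem_singleton] at hp hq
      subst hp
      simp only [sig_self, shift_lt hl, leEff]
      grind
    · simp only [dom, if_true, mem_singleton] at hq
      subst hq
      have e1 : ∀ k, shift (l + 1) (l + 1) (l + 1) l k = 0 := by simp [shift_self]
      have e2 : ∀ k, shift (l + 1) (l + 1) (l + 1) (l + 1) k = if k = l + 1 then -1 else 0 := by
        simp [shift_self]
      simp only [wtl, if_neg hl.ne, if_neg hl.not_gt, Pi.add_apply,
        sum_add_distrib, e1, e2, sum_ite_eq', mem_Icc, sum_const_zero]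
      grind
    · simp only [dom, if_neg hl.ne, if_neg hl.not_gt, mem_Icc] at hq
      have e2 : ∀ k, shift (l + 1) l q (l + 1) k = if k = q then 1 else 0 := by
        intro k; simp [shift_lt hl]
      have e3 : ∀ k ∈ Icc 1 l, shift (l + 1) l q k (l + 1) =
          if k = l then if q = l + 1 then -1 else 0 else 0 := by
        intro k hk
        rw [mem_Icc] at hk
        simp only [shift_lt hl]
        grind
      simp only [wtl, if_true, Pi.add_apply, sum_add_distrib, Nat.add_sub_cancel]
      rw [sum_congr rfl e3]
      simp only [e2, sum_ite_eq', mem_Icc]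
      grind
  · refine ⟨fun q hq p hp => ?_, fun q hq p hp => ?_, fun A q hq => ?_, fun A q hq => ?_⟩
    · simp only [dom, if_neg hl.ne, if_neg hl.not_gt, if_neg hl1.ne, if_neg hl1.not_gt,
        mem_Icc] at hp hq
      simp only [sig_lt hl, shift_lt hl1, sum_ite_eq', mem_Icc, ltEff]
      grind
    · simp only [dom, if_neg hl.ne, if_neg hl.not_gt, if_neg hl1.ne, if_neg hl1.not_gt,
        mem_Icc] at hp hq
      simp only [sig_lt hl1, shift_lt hl, sum_ite_eq', mem_Icc, leEff]
      grind
    · simp only [dom, if_neg hl1.ne, if_neg hl1.not_gt, mem_Icc] at hq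
      simp only [wtl, if_neg hl.ne, if_neg hl.not_gt, Pi.add_apply, sum_add_distrib,
        shift_lt hl1, sum_ite_eq', mem_Icc]
      grind
    · simp only [dom, if_neg hl.ne, if_neg hl.not_gt, mem_Icc] at hq
      simp only [wtl, if_neg hl1.ne, if_neg hl1.not_gt, Pi.add_apply, sum_add_distrib,
        shift_lt hl, sum_ite_eq', mem_Icc]
      grind

theorem exists_of_eop {n i m l : ℕ} {pos : ℕ → ℤ} (hi : 1 ≤ i) (hin : i ≤ n)
    (hpos : Reads pos i l) {A B : Arr} (h : eop n i m l A = some B) :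
    ∃ q, LastMax pos (dom n i l) (sig i l A) q ∧ sig i l A q ≠ 0 ∧ B = A + shift i l q := by
  obtain ⟨q, hq⟩ := exists_lastMax pos _ (dom_nonempty hi hin l) (sig i l A)
  have h0 : sig i l A q ≠ 0 := by
    intro h0
    rw [eop, if_pos (by rw [eps_eq hi hpos hq, h0])] at h
    exact absurd h (by simp)
  refine ⟨q, hq, h0, ?_⟩
  rw [eop_eq hi hpos hq h0] at h
  exact (Option.some.inj h).symm

/-- The third Stembridge axiom for neighbouring nodes. -/
theorem stembridge_of_linked {n i m l j : ℕ} {pos : ℕ → ℤ} (hi : 1 ≤ i) (hin : i ≤ n)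
    (hL : Linked n i m pos l j) (hl : Reads pos i l) (hj : Reads pos i j)
    {A Al Aj : Arr} (hεl : 0 ≤ eps n i m l A) (hεj : 0 ≤ eps n i m j A)
    (hφl : 0 ≤ phi n i m l A) (hφj : 0 ≤ phi n i m j A)
    (hAl : eop n i m l A = some Al) (hAj : eop n i m j A = some Aj)
    (h1 : eps n i m j A - eps n i m j Al = -1)
    (h2 : eps n i m l A - eps n i m l Aj = -1) :
    ∃ A',
      ((((eop n i m l A).bind (eop n i m j)).bind (eop n i m j)).bind (eop n i m l)
          = some A') ∧
      ((((eop n i m j A).bind (eop n i m l)).bind (eop n i m l)).bind (eop n i m j)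
          = some A') ∧
      (∃ B, fop n i m j A' = some B ∧ phi n i m l A' - phi n i m l B = -1) ∧
      (∃ B, fop n i m l A' = some B ∧ phi n i m j A' - phi n i m j B = -1) := by
  obtain ⟨q, hq, hq0, rfl⟩ := exists_of_eop hi hin hl hAl
  obtain ⟨r, hr, hr0, rfl⟩ := exists_of_eop hi hin hj hAj
  rw [eps_eq hi hj hr] at h1 hεj
  rw [eps_eq hi hl hq] at h2 hεl
  have hT : ∃ t ∈ dom n i j, pos t < pos q ∧ sig i j A t = sig i j A r := by
    obtain ⟨t, ht⟩ := exists_lastMax pos _ (dom_nonempty hi hin j) (sig i j (A + shift i l q))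
    rw [eps_eq hi hj ht, sig_add, hL.sig_right q hq.1 t ht.1] at h1
    have := (hr.2 t ht.1).1
    refine ⟨t, ht.1, ?_⟩
    simp only [ltEff] at h1
    grind
  have hS : ∃ t ∈ dom n i l, pos t ≤ pos r ∧ sig i l A t = sig i l A q := by
    obtain ⟨t, ht⟩ := exists_lastMax pos _ (dom_nonempty hi hin l) (sig i l (A + shift i j r))
    rw [eps_eq hi hl ht, sig_add, hL.sig_left r hr.1 t ht.1] at h2
    have := (hq.2 t ht.1).1
    refine ⟨t, ht.1, ?_⟩
    simp only [leEff] at h2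
    grind
  obtain ⟨r₁, r₂, s, q₁, q₂, t, hr₁, vr₁, hr₂, vr₂, hs, vs, hq₁, vq₁, hq₂, vq₂, ht, vt, eq, er⟩ :=
    signature_paths pos _ _ _ _ q r hq hr hT hS
  have Fq := hL.sig_right q hq.1
  have Fr := hL.sig_left r hr.1
  have Fr₁ := hL.sig_left r₁ hr₁.1
  have Fr₂ := hL.sig_left r₂ hr₂.1
  have Fq₁ := hL.sig_right q₁ hq₁.1
  have Fq₂ := hL.sig_right q₂ hq₂.1
  have Sq := fun p (hp : p ∈ dom n i l) => sig_shift_same hi hl hq.1 hp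
  have Sq₁ := fun p (hp : p ∈ dom n i l) => sig_shift_same hi hl hq₁.1 hp
  have Sr := fun p (hp : p ∈ dom n i j) => sig_shift_same hi hj hr.1 hp
  have Sr₁ := fun p (hp : p ∈ dom n i j) => sig_shift_same hi hj hr₁.1 hp
  -- The signatures along the two paths.
  have a1 : ∀ p ∈ dom n i j, sig i j (A + shift i l q) p = sig i j A p + ltEff pos q p := by
    intro p hp; rw [sig_add, Fq p hp]
  have a2 : ∀ p ∈ dom n i j, sig i j (A + shift i l q + shift i j r₁) p =
      sig i j A p + ltEff pos q p + selfEff pos r₁ p := by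
    intro p hp; rw [sig_add, a1 p hp, Sr₁ p hp]
  have a3 : ∀ p ∈ dom n i l, sig i l (A + shift i l q + shift i j r₁ + shift i j r₂) p =
      sig i l A p + selfEff pos q p + leEff pos r₁ p + leEff pos r₂ p := by
    intro p hp; rw [sig_add, sig_add, sig_add, Sq p hp, Fr₁ p hp, Fr₂ p hp]
  have b1 : ∀ p ∈ dom n i l, sig i l (A + shift i j r) p = sig i l A p + leEff pos r p := by
    intro p hp; rw [sig_add, Fr p hp]
  have b2 : ∀ p ∈ dom n i l, sig i l (A + shift i j r + shift i l q₁) p =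
      sig i l A p + leEff pos r p + selfEff pos q₁ p := by
    intro p hp; rw [sig_add, b1 p hp, Sq₁ p hp]
  have b3 : ∀ p ∈ dom n i j, sig i j (A + shift i j r + shift i l q₁ + shift i l q₂) p =
      sig i j A p + selfEff pos r p + ltEff pos q₁ p + ltEff pos q₂ p := by
    intro p hp; rw [sig_add, sig_add, sig_add, Sr p hp, Fq₁ p hp, Fq₂ p hp]
  replace hr₁ := hr₁.congr a1
  replace hr₂ := hr₂.congr a2
  replace hs := hs.congr a3
  replace hq₁ := hq₁.congr b1
  replace hq₂ := hq₂.congr b2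
  replace ht := ht.congr b3
  rw [← a1 _ hr₁.1] at vr₁
  rw [← a2 _ hr₂.1] at vr₂
  rw [← a3 _ hs.1] at vs
  rw [← b1 _ hq₁.1] at vq₁
  rw [← b2 _ hq₂.1] at vq₂
  rw [← b3 _ ht.1] at vt
  have hA' : A + shift i j r + shift i l q₁ + shift i l q₂ + shift i j t =
      A + shift i l q + shift i j r₁ + shift i j r₂ + shift i l s := by
    rcases eq with ⟨rfl, rfl⟩ | ⟨rfl, rfl⟩ <;> rcases er with ⟨rfl, rfl⟩ | ⟨rfl, rfl⟩ <;> abel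
  have εl := eps_add_shift_same (m := m) hi hin hl hs
  have εj := eps_add_shift_same (m := m) hi hin hj ht
  have εj' := eps_add_shift_same (m := m) hi hin hj hr₂
  have εl' := eps_add_shift_same (m := m) hi hin hl hq₂
  rw [hA'] at εj
  have φl := phi_eq (m := m) (l := l) hi hin A
  have φj := phi_eq (m := m) (l := j) hi hin A
  have wl := wtl_add_shift_same (m := m) hi hin
    (A + shift i l q + shift i j r₁ + shift i j r₂) hs.1
  have wl' := hL.wt_left (A + shift i l q + shift i j r₁) r₂ hr₂.1
  have wl'' := hL.wt_left (A + shift i l q) r₁ hr₁.1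
  have wl''' := wtl_add_shift_same (m := m) hi hin A hq.1
  have wj := wtl_add_shift_same (m := m) hi hin
    (A + shift i j r + shift i l q₁ + shift i l q₂) ht.1
  have wj' := hL.wt_right (A + shift i j r + shift i l q₁) q₂ hq₂.1
  have wj'' := hL.wt_right (A + shift i j r) q₁ hq₁.1
  have wj''' := wtl_add_shift_same (m := m) hi hin A hr.1
  have wlj := hL.wt_left (A + shift i j r + shift i l q₁ + shift i l q₂) t ht.1
  have wjl := hL.wt_right (A + shift i l q + shift i j r₁ + shift i j r₂) s hs.1
  have φl' := phi_eq (m := m) (l := l) hi hin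
    (A + shift i l q + shift i j r₁ + shift i j r₂ + shift i l s)
  have φj' := phi_eq (m := m) (l := j) hi hin
    (A + shift i j r + shift i l q₁ + shift i l q₂ + shift i j t)
  rw [eps_eq hi hl hq] at φl
  rw [eps_eq hi hj hr] at φj
  refine ⟨A + shift i l q + shift i j r₁ + shift i j r₂ + shift i l s, ?_, ?_,
    ⟨A + shift i j r + shift i l q₁ + shift i l q₂, ?_, ?_⟩,
    ⟨A + shift i l q + shift i j r₁ + shift i j r₂, ?_, ?_⟩⟩
  · rw [hAl, Option.bind_some, eop_eq hi hj hr₁ (by omega), Option.bind_some,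
      eop_eq hi hj hr₂ (by omega), Option.bind_some, eop_eq hi hl hs (by omega)]
  · rw [hAj, Option.bind_some, eop_eq hi hl hq₁ (by omega), Option.bind_some,
      eop_eq hi hl hq₂ (by omega), Option.bind_some, eop_eq hi hj ht (by omega), hA']
  · rw [← hA']
    refine fop_eq hi hj ht ?_
    rw [hA'] at *
    omega
  · rw [φl', phi_eq hi hin (A + shift i j r + shift i l q₁ + shift i l q₂), εl, εl']
    rw [hA'] at wlj
    omega
  · exact fop_eq hi hl hs (by omega)
  · rw [← hA', φj', hA', phi_eq hi hin (A + shift i l q + shift i j r₁ + shift i j r₂), εj, εj']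
    omega

theorem eps_congr {n i m j : ℕ} {pos : ℕ → ℤ} (hi : 1 ≤ i) (hin : i ≤ n) (hpos : Reads pos i j)
    {A B : Arr} (h : ∀ p ∈ dom n i j, sig i j B p = sig i j A p) :
    eps n i m j B = eps n i m j A := by
  obtain ⟨u, hu⟩ := exists_lastMax pos _ (dom_nonempty hi hin j) (sig i j A)
  rw [eps_eq hi hpos hu, eps_eq hi hpos (hu.congr h), h u hu.1]

theorem exists_reads (i l : ℕ) : ∃ pos, Reads pos i l := by
  rcases lt_or_ge i l with h | h
  · exact ⟨fun p => p, fun _ => rfl, fun h' => absurd h' h.not_gt⟩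
  · exact ⟨fun p => -p, fun h' => absurd h' h.not_gt, fun _ => rfl⟩

theorem eps_eop_of_opposite {n i m l j : ℕ} (hi : 1 ≤ i) (hin : i ≤ n) (hl0 : 1 ≤ l)
    (hl : l < i) (hj : i < j) (hjn : j ≤ n) {A B : Arr} (h : eop n i m l A = some B) :
    eps n i m j B = eps n i m j A := by
  obtain ⟨q, hq, -, rfl⟩ := exists_of_eop (pos := fun p => -(p : ℤ)) hi hin
    ⟨fun h => absurd h hl.not_gt, fun _ => rfl⟩ h
  have hR : Reads (fun p => (p : ℤ)) i j := ⟨fun _ => rfl, fun h => absurd h hj.not_gt⟩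
  obtain ⟨u, hu⟩ := exists_lastMax _ _ (dom_nonempty hi hin j) (sig i j A)
  obtain ⟨v, hv⟩ := exists_lastMax _ _ (dom_nonempty hi hin j) (sig i j (A + shift i l q))
  rw [eps_eq hi hR hu, eps_eq hi hR hv]
  have hdl : dom n i l = Icc i n := by simp [dom, hl.ne, hl.not_gt]
  have hdj : dom n i j = Icc 1 i := by simp [dom, hj.ne', hj]
  have hsh : ∀ p, sig i j (shift i l q) p = (if q = j ∧ p = l + 1 then 1 else 0) -
      if q = j - 1 ∧ p = l then 1 else 0 := by
    intro p
    have e : ∀ b k, shift i l q k b = (if k = l then if b = q then -1 else 0 else 0) +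
        if k = l + 1 then if b = q then 1 else 0 else 0 := by
      intro b k
      rw [shift_lt hl]
      grind
    simp only [sig_gt hj, e, sum_add_distrib, sum_ite_eq', mem_Icc]
    grind
  have d1 : sig i j A l = sig i j A (l + 1) + A l j - A (l + 1) (j - 1) := by
    have e1 := sum_Icc_split' (fun k => A k j) (le_refl l) hl.le
    have e2 := sum_Icc_split' (fun k => A k (j - 1)) (le_refl (l + 1)) hl
    simp only [sig_gt hj, Icc_self, sum_singleton] at *
    linarith
  have d2 : sig i l A j = sig i l A (j - 1) + A l j - A (l + 1) (j - 1) := by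
    have e1 := sum_Icc_split (fun k => A l k) hi hj.le le_rfl
    have e2 := sum_Icc_split (fun k => A (l + 1) k) hi (show i ≤ j - 1 by omega) le_rfl
    simp only [sig_lt hl, Icc_self, sum_singleton] at *
    linarith
  have c1 := hq.2 j (by rw [hdl, mem_Icc]; omega)
  have c2 := hq.2 (j - 1) (by rw [hdl, mem_Icc]; omega)
  have c3 := hu.2 l (by rw [hdj, mem_Icc]; omega)
  have c4 := hu.2 (l + 1) (by rw [hdj, mem_Icc]; omega)
  have c5 := hv.2 l (by rw [hdj, mem_Icc]; omega)
  have c6 := hv.2 (l + 1) (by rw [hdj, mem_Icc]; omega)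
  have c7 := hu.2 v hv.1
  have c8 := hv.2 u hu.1
  simp only [sig_add, hsh] at *
  grind

theorem eps_eop_of_far {n i m l j : ℕ} (hi : 1 ≤ i) (hin : i ≤ n) (hl0 : 1 ≤ l)
    (hlj : l + 1 < j) (hjn : j ≤ n) {A B : Arr} (h : eop n i m l A = some B) :
    eps n i m j B = eps n i m j A := by
  by_cases hopp : l < i ∧ i < j
  · exact eps_eop_of_opposite hi hin hl0 hopp.1 hopp.2 hjn h
  obtain ⟨pos, hpos⟩ := exists_reads i l
  obtain ⟨q, hq, -, rfl⟩ := exists_of_eop hi hin hpos h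
  obtain ⟨pos', hpos'⟩ := exists_reads i j
  refine eps_congr hi hin hpos' fun p hp => ?_
  have key : sig i j (shift i l q) p = 0 := by
    rcases lt_trichotomy j i with hj | rfl | hj
    · have hl : l < i := by omega
      have e1 : ∀ k, shift i l q j k = 0 := by intro k; rw [shift_lt hl]; grind
      have e2 : ∀ k, shift i l q (j + 1) k = 0 := by intro k; rw [shift_lt hl]; grind
      simp only [sig_lt hj, e1, e2, sum_const_zero, sub_zero]
    · have hl : l < j := by omega
      rw [sig_self, shift_lt hl]
      grind
    · have hl : i ≤ l := by omega
      have e1 : ∀ k, shift i l q k j = 0 := by intro k; simp only [shift]; grind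
      have e2 : ∀ k, shift i l q k (j - 1) = 0 := by intro k; simp only [shift]; grind
      simp only [sig_gt hj, e1, e2, sum_const_zero, sub_zero]
  rw [sig_add, key, add_zero]

theorem exists_path_column (A : Arr) (i n d : ℕ) : ∀ q, q + d = n → ∃ L : List (ℕ × ℕ),
    ((i, q) :: L).getLast? = some (i, n) ∧
    ((i, q) :: L).IsChain (fun β γ => γ = (β.1, β.2 + 1) ∨ γ = (β.1 + 1, β.2)) ∧
    (((i, q) :: L).map fun β => A β.1 β.2).sum = ∑ k ∈ Icc q n, A i k := by
  induction d with
  | zero =>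
    rintro q rfl
    exact ⟨[], by simp⟩
  | succ d ih =>
    intro q hq
    obtain ⟨L, h1, h2, h3⟩ := ih (q + 1) (by omega)
    refine ⟨(i, q + 1) :: L, by rwa [List.getLast?_cons_cons],
      List.isChain_cons_cons.2 ⟨.inl rfl, h2⟩, ?_⟩
    have := sum_Icc_split' (fun k => A i k) (le_refl q) (show q ≤ n by omega)
    rw [List.map_cons, List.sum_cons, h3, ← this]
    simp

theorem exists_path_hook (A : Arr) {i n : ℕ} (hin : i ≤ n) (d : ℕ) :
    ∀ p, 1 ≤ p → p + d = i → ∃ L : List (ℕ × ℕ),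
    ((p, i) :: L).getLast? = some (i, n) ∧
    ((p, i) :: L).IsChain (fun β γ => γ = (β.1, β.2 + 1) ∨ γ = (β.1 + 1, β.2)) ∧
    (((p, i) :: L).map fun β => A β.1 β.2).sum =
      ∑ k ∈ Icc p (i - 1), A k i + ∑ k ∈ Icc i n, A i k := by
  induction d with
  | zero =>
    rintro p hp hpi
    obtain rfl : p = i := hpi
    obtain ⟨L, h1, h2, h3⟩ := exists_path_column A p n (n - p) p (by omega)
    refine ⟨L, h1, h2, ?_⟩
    rw [h3, Icc_eq_empty (show ¬ p ≤ p - 1 by omega)]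
    simp
  | succ d ih =>
    intro p hp hpi
    obtain ⟨L, h1, h2, h3⟩ := ih (p + 1) (by omega) (by omega)
    refine ⟨(p + 1, i) :: L, by rwa [List.getLast?_cons_cons],
      List.isChain_cons_cons.2 ⟨.inr rfl, h2⟩, ?_⟩
    have := sum_Icc_split' (fun k => A k i) (le_refl p) (show p ≤ i - 1 by omega)
    rw [List.map_cons, List.sum_cons, h3, ← this]
    simp [add_assoc]

theorem InB.eps_nonneg {n i m l : ℕ} {A : Arr} (hA : InB n i m A) (hi : 1 ≤ i) (hin : i ≤ n)
    (hl0 : 1 ≤ l) (hln : l ≤ n) : 0 ≤ eps n i m l A := by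
  obtain ⟨pos, hpos⟩ := exists_reads i l
  obtain ⟨u, hu⟩ := exists_lastMax pos _ (dom_nonempty hi hin l) (sig i l A)
  rw [eps_eq hi hpos hu]
  have hid : i ∈ dom n i l := by
    unfold dom
    split_ifs <;> simp [hi, hin]
  refine le_trans ?_ (hu.2 i hid).1
  rcases lt_trichotomy l i with hl | rfl | hl
  · rw [sig_lt hl, Icc_eq_empty (show ¬ i ≤ i - 1 by omega)]
    simpa using hA.1 l i hl0 hl.le le_rfl hin
  · simpa [sig_self] using hA.1 l l hi le_rfl le_rfl hin
  · rw [sig_gt hl]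
    simpa using hA.1 i l hi le_rfl hl.le hln

theorem InB.phi_nonneg {n i m l : ℕ} {A : Arr} (hA : InB n i m A) (hi : 1 ≤ i) (hin : i ≤ n)
    (hl0 : 1 ≤ l) (hln : l ≤ n) : 0 ≤ phi n i m l A := by
  obtain ⟨pos, hpos⟩ := exists_reads i l
  obtain ⟨u, hu⟩ := exists_lastMax pos _ (dom_nonempty hi hin l) (sig i l A)
  rcases lt_trichotomy l i with hl | rfl | hl
  · rw [phi_eq hi hin, eps_eq hi hpos hu]
    have h1 := (hu.2 n (by simp [dom, hl.ne, hl.not_gt, hin])).1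
    have h2 := hA.1 (l + 1) n (by omega) hl hin le_rfl
    have e := sum_Icc_split (fun k => A (l + 1) k) hi hin le_rfl
    rw [sig_lt hl A n] at h1
    simp only [wtl, if_neg hl.ne, if_neg hl.not_gt, Icc_self, sum_singleton] at *
    linarith
  · obtain ⟨L, h1, h2, h3⟩ := exists_path_hook A hin (l - 1) 1 le_rfl (by omega)
    have := hA.2.2 ((1, l) :: L) ⟨by simp, by simp, h1, h2⟩
    simp only [phi, if_true]
    linarith
  · rw [phi_eq hi hin, eps_eq hi hpos hu]
    have h1 := (hu.2 1 (by simp [dom, hl.ne', hl, hi])).1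
    have h2 := hA.1 1 (l - 1) le_rfl hi (by omega) (by omega)
    have e := sum_Icc_split' (fun k => A k (l - 1)) (le_refl 1) hi
    rw [sig_gt hl A 1] at h1
    simp only [wtl, if_neg hl.ne', if_pos hl, Icc_self, sum_singleton] at *
    linarith

/-- Third Stembridge axiom: if `e_l A, e_j A ≠ 0` and
`ε_j(A) − ε_j(e_l A) = ε_l(A) − ε_l(e_j A) = −1`, then
`e_l e_j² e_l A = e_j e_l² e_j A ≠ 0` and for this common element `A'` we have
`φ_l(A') − φ_l(f_j A') = φ_j(A') − φ_j(f_l A') = −1`. -/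
theorem stmt11 (n i m : ℕ) (hi : 1 ≤ i) (hin : i ≤ n) (A : Arr) (hA : InB n i m A)
    (l : ℕ) (hl : l ∈ Finset.Icc 1 n) (j : ℕ) (hj : j ∈ Finset.Icc 1 n) (hjl : j ≠ l)
    (Al Aj : Arr) (hAl : eop n i m l A = some Al) (hAj : eop n i m j A = some Aj)
    (h1 : eps n i m j A - eps n i m j Al = -1)
    (h2 : eps n i m l A - eps n i m l Aj = -1) :
    ∃ A',
      ((((eop n i m l A).bind (eop n i m j)).bind (eop n i m j)).bind (eop n i m l)
          = some A') ∧
      ((((eop n i m j A).bind (eop n i m l)).bind (eop n i m l)).bind (eop n i m j)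
          = some A') ∧
      (∃ B, fop n i m j A' = some B ∧ phi n i m l A' - phi n i m l B = -1) ∧
      (∃ B, fop n i m l A' = some B ∧ phi n i m j A' - phi n i m j B = -1) := by
  rw [mem_Icc] at hl hj
  have εl := hA.eps_nonneg hi hin hl.1 hl.2
  have εj := hA.eps_nonneg hi hin hj.1 hj.2
  have φl := hA.phi_nonneg hi hin hl.1 hl.2
  have φj := hA.phi_nonneg hi hin hj.1 hj.2
  have up : ∀ k, i ≤ k → Reads (fun p : ℕ => (p : ℤ)) i k :=
    fun k hk => ⟨fun _ => rfl, fun h => absurd h hk.not_gt⟩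
  have down : ∀ k, k ≤ i → Reads (fun p : ℕ => -(p : ℤ)) i k :=
    fun k hk => ⟨fun h => absurd h hk.not_gt, fun _ => rfl⟩
  rcases lt_or_gt_of_ne hjl with hlt | hlt
  · by_cases hadj : l = j + 1
    · subst hadj
      rcases le_or_gt i j with hij | hij
      · obtain ⟨A', c1, c2, c3, c4⟩ := stembridge_of_linked hi hin
          (linked_above m hi hij hl.2) (up _ hij) (up _ (by omega))
          εj εl φj φl hAj hAl h2 h1
        exact ⟨A', c2, c1, c4, c3⟩
      · exact stembridge_of_linked hi hin (linked_below m hin hj.1 hij) (down _ hij)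
          (down _ hij.le) εl εj φl φj hAl hAj h1 h2
    · have := eps_eop_of_far hi hin hj.1 (by omega) hl.2 hAj
      omega
  · by_cases hadj : j = l + 1
    · subst hadj
      rcases le_or_gt i l with hil | hil
      · exact stembridge_of_linked hi hin (linked_above m hi hil hj.2) (up _ hil)
          (up _ (by omega)) εl εj φl φj hAl hAj h1 h2
      · obtain ⟨A', c1, c2, c3, c4⟩ := stembridge_of_linked hi hin
          (linked_below m hin hl.1 hil) (down _ hil) (down _ hil.le)
          εj εl φj φl hAj hAl h2 h1
        exact ⟨A', c2, c1, c4, c3⟩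
    · have := eps_eop_of_far hi hin hl.1 (by omega) hj.2 hAl
      omega

end KR
end
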